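/- arXiv:2509.09220 — 2 statements merged into one kernel-verified Lean document; each statement's English description precedes it below -/
import Mathlib

section
/- Let A = σ(R)⟨x_1,…,x_n⟩ be a skew PBW extension of a ring R, where R is (Σ,Δ)-compatible, Abelian, NI, and satisfies condition (SA1). If R is a right p.p.-ring, then A has Property (a.c.) on the right. -/
/-! Basic annihilator-condition definitions for (noncommutative) rings. -/

/-- The right annihilator `r_S(X) = {a ∈ S | Xa = 0}` of a subset `X` of a ring `S`. -/
def rAnn {S : Type*} [Ring S] (X : Set S) : Set S := {a | ∀ x ∈ X, x * a = 0}

/-- The left annihilator `ℓ_S(X) = {a ∈ S | aX = 0}` of a subset `X` of a ring `S`. -/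
def lAnn {S : Type*} [Ring S] (X : Set S) : Set S := {a | ∀ x ∈ X, a * x = 0}

/-- The principal right ideal `xS` of a ring `S`. -/
def rIdeal {S : Type*} [Ring S] (x : S) : Set S := Set.range fun s => x * s

/-- The principal left ideal `Sx` of a ring `S`. -/
def lIdeal {S : Type*} [Ring S] (x : S) : Set S := Set.range fun s => s * x

/-- A ring `S` is Baer if the right annihilator of every nonempty subset is
generated (as a right ideal) by an idempotent. -/
def IsBaerRing (S : Type*) [Ring S] : Prop :=
  ∀ X : Set S, X.Nonempty → ∃ e : S, e * e = e ∧ rAnn X = rIdeal e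

/-- A ring `S` is a right p.p.-ring if the right annihilator of every element is
generated by an idempotent. -/
def IsRightPP (S : Type*) [Ring S] : Prop :=
  ∀ a : S, ∃ e : S, e * e = e ∧ rAnn {a} = rIdeal e

/-- A ring `S` is a left p.p.-ring if the left annihilator of every element is
generated by an idempotent. -/
def IsLeftPP (S : Type*) [Ring S] : Prop :=
  ∀ a : S, ∃ e : S, e * e = e ∧ lAnn {a} = lIdeal e

/-- A ring `S` is right p.q.-Baer if the right annihilator of every principal right
ideal is generated by an idempotent. -/
def IsRightPQBaer (S : Type*) [Ring S] : Prop :=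
  ∀ a : S, ∃ e : S, e * e = e ∧ rAnn (rIdeal a) = rIdeal e

/-- A ring `S` is left p.q.-Baer if the left annihilator of every principal left
ideal is generated by an idempotent. -/
def IsLeftPQBaer (S : Type*) [Ring S] : Prop :=
  ∀ a : S, ∃ e : S, e * e = e ∧ lAnn (lIdeal a) = lIdeal e

/-- Property (a.c.) on the right: for every finitely generated right ideal
`I = a₁S + ⋯ + a_mS` there is `c` with `r_S(I) = r_S(cS)`. -/
def HasRightAC (S : Type*) [Ring S] : Prop :=
  ∀ (m : ℕ) (a : Fin m → S), ∃ c : S,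
    rAnn {y : S | ∃ s : Fin m → S, y = ∑ i, a i * s i} = rAnn (rIdeal c)

/-- Property (a.c.) on the left: for every finitely generated left ideal
`I = Sa₁ + ⋯ + Sa_m` there is `c` with `ℓ_S(I) = ℓ_S(Sc)`. -/
def HasLeftAC (S : Type*) [Ring S] : Prop :=
  ∀ (m : ℕ) (a : Fin m → S), ∃ c : S,
    lAnn {y : S | ∃ s : Fin m → S, y = ∑ i, s i * a i} = lAnn (lIdeal c)

/-- A ring is Abelian if every idempotent is central. -/
def IsAbelianRing (S : Type*) [Ring S] : Prop :=
  ∀ e : S, e * e = e → ∀ r : S, e * r = r * e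

/-- A ring `S` is NI if the set of nilpotent elements coincides with the upper
nilradical `nil*(S)`, the sum of all (two-sided) nil ideals of `S`. -/
def IsNIRing (S : Type*) [Ring S] : Prop :=
  {a : S | IsNilpotent a} =
    ((sSup {I : TwoSidedIdeal S | ∀ x ∈ I, IsNilpotent x} : TwoSidedIdeal S) : Set S)

/-- `σ^α = σ₁^{α₁} ∘ ⋯ ∘ σₙ^{αₙ}` for a family of ring endomorphisms. -/
def sigmaPow {R : Type*} [Ring R] {n : ℕ} (σ : Fin n → R →+* R) (α : Fin n → ℕ) : R → R :=
  (List.ofFn fun i => (⇑(σ i))^[α i]).foldr (· ∘ ·) id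

/-- `δ^α = δ₁^{α₁} ∘ ⋯ ∘ δₙ^{αₙ}` for a family of maps. -/
def deltaPow {R : Type*} {n : ℕ} (δ : Fin n → R → R) (α : Fin n → ℕ) : R → R :=
  (List.ofFn fun i => (δ i)^[α i]).foldr (· ∘ ·) id

/-- The ordered standard monomial `x^α = x₁^{α₁} ⋯ xₙ^{αₙ}`. -/
def monom {A : Type*} [Ring A] {n : ℕ} (x : Fin n → A) (α : Fin n → ℕ) : A :=
  (List.ofFn fun i => x i ^ α i).prod

/-- A skew PBW extension `A = σ(R)⟨x₁,…,xₙ⟩` of a ring `R`: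
`R` embeds in `A` (sharing the identity), `A` is a free left `R`-module with basis the
standard monomials, there are injective endomorphisms `σᵢ` and `σᵢ`-derivations `δᵢ`
with `xᵢ r = σᵢ(r) xᵢ + δᵢ(r)`, and `xⱼxᵢ - d_{i,j} xᵢxⱼ ∈ R + Rx₁ + ⋯ + Rxₙ`
with `d_{i,j} ≠ 0`. -/
structure SkewPBWExt (R A : Type*) [Ring R] [Ring A] (n : ℕ) where
  /-- the inclusion of `R` into `A` -/
  ι : R →+* A
  ι_inj : Function.Injective ι
  /-- the variables `x₁, …, xₙ` -/
  x : Fin n → A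
  /-- the endomorphisms `σᵢ` -/
  σ : Fin n → R →+* R
  σ_inj : ∀ i, Function.Injective (σ i)
  /-- the `σᵢ`-derivations `δᵢ` -/
  δ : Fin n → R → R
  δ_add : ∀ (i : Fin n) (a b : R), δ i (a + b) = δ i a + δ i b
  δ_leibniz : ∀ (i : Fin n) (a b : R), δ i (a * b) = σ i a * δ i b + δ i a * b
  comm_rel : ∀ (i : Fin n) (r : R), x i * ι r = ι (σ i r) * x i + ι (δ i r)
  /-- `A` is a free left `R`-module with basis the standard monomials: every element
  has a unique representation as a finite left `R`-linear combination of monomials. -/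
  basis : ∀ f : A, ∃! c : (Fin n → ℕ) →₀ R, f = c.sum fun α r => ι r * monom x α
  /-- the constants `d_{i,j}` -/
  d : Fin n → Fin n → R
  d_ne : ∀ i j, d i j ≠ 0
  quad : ∀ i j, ∃ (r0 : R) (rc : Fin n → R),
    x j * x i - ι (d i j) * (x i * x j) = ι r0 + ∑ k, ι (rc k) * x k

namespace SkewPBWExt

variable {R A : Type*} [Ring R] [Ring A] {n : ℕ}

/-- `R` is `(Σ,Δ)`-compatible. -/
def SigmaDeltaCompatible (E : SkewPBWExt R A n) : Prop :=
  ∀ (a b : R) (α : Fin n → ℕ),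
    (a * b = 0 ↔ a * sigmaPow E.σ α b = 0) ∧ (a * b = 0 → a * deltaPow E.δ α b = 0)

/-- `R` is `Σ`-rigid. -/
def SigmaRigid (E : SkewPBWExt R A n) : Prop :=
  ∀ (a : R) (α : Fin n → ℕ), a * sigmaPow E.σ α a = 0 → a = 0

/-- Condition (SA1): if `fg = 0` in `A` then all products of coefficients vanish. -/
def SA1 (E : SkewPBWExt R A n) : Prop :=
  ∀ cf cg : (Fin n → ℕ) →₀ R,
    (cf.sum fun α r => E.ι r * monom E.x α) * (cg.sum fun β r => E.ι r * monom E.x β) = 0 →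
    ∀ α β, cf α * cg β = 0

/-- The extension is bijective: every `σᵢ` is bijective and every `d_{i,j}` (`i < j`)
is invertible in `R`. -/
def Bijective (E : SkewPBWExt R A n) : Prop :=
  (∀ i, Function.Bijective (E.σ i)) ∧ ∀ i j : Fin n, i < j → IsUnit (E.d i j)

end SkewPBWExt


/-- If every `αⱼ` vanishes, then `δ^α` is the identity. -/
theorem deltaPow_zero {R : Type*} {n : ℕ} (f : Fin n → R → R) :
    deltaPow f (fun _ => 0) = id := by
  induction n with
  | zero => simp [deltaPow]
  | succ n ih =>
    have h := ih fun j => f j.succ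
    simp only [deltaPow, List.ofFn_succ, List.foldr_cons] at h ⊢
    rw [h]
    rfl

/-- For the `i`-th unit vector `α`, the map `δ^α` is `δᵢ`. -/
theorem deltaPow_single {R : Type*} {n : ℕ} (f : Fin n → R → R) (i : Fin n) :
    deltaPow f (fun j => if j = i then 1 else 0) = f i := by
  induction n with
  | zero => exact i.elim0
  | succ n ih =>
    refine Fin.cases ?_ (fun k => ?_) i
    · have h := deltaPow_zero fun j => f j.succ
      simp only [deltaPow, List.ofFn_succ, List.foldr_cons, Fin.succ_ne_zero, if_true,
        if_false] at h ⊢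
      rw [h]
      rfl
    · have h := ih (fun j => f j.succ) k
      simp only [deltaPow, List.ofFn_succ, List.foldr_cons, Fin.succ_inj,
        (Fin.succ_ne_zero k).symm, if_false] at h ⊢
      rw [h]
      rfl

/-- For the `i`-th unit vector `α`, the map `σ^α` is `σᵢ`. -/
theorem sigmaPow_single {R : Type*} [Ring R] {n : ℕ} (σ : Fin n → R →+* R) (i : Fin n) :
    sigmaPow σ (fun j => if j = i then 1 else 0) = σ i :=
  deltaPow_single (fun j => ⇑(σ j)) i

/-- In an Abelian right p.p.-ring, the right annihilator of a finite set is generated by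
an idempotent. -/
theorem IsRightPP.exists_idempotent_finset {R : Type*} [Ring R] (hpp : IsRightPP R)
    (hAb : IsAbelianRing R) (T : Finset R) :
    ∃ e : R, e * e = e ∧ (∀ a ∈ T, a * e = 0) ∧ ∀ b, (∀ a ∈ T, a * b = 0) → e * b = b := by
  classical
  induction T using Finset.induction_on with
  | empty => exact ⟨1, by simp⟩
  | insert a T _ ih =>
    obtain ⟨e, he, heT, heb⟩ := ih
    obtain ⟨u, hu, hua⟩ := hpp a
    have hau : a * u = 0 := by
      have : u ∈ rAnn {a} := hua ▸ ⟨u, hu⟩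
      exact this a rfl
    refine ⟨u * e, ?_, ?_, fun b hb => ?_⟩
    · rw [mul_assoc, ← mul_assoc e, hAb e he u, mul_assoc u e e, he, ← mul_assoc, hu]
    · intro t ht
      rcases Finset.mem_insert.mp ht with rfl | ht
      · rw [← mul_assoc, hau, zero_mul]
      · rw [hAb u hu, ← mul_assoc, heT t ht, zero_mul]
    · have hbu : b ∈ rIdeal u := by
        rw [← hua]
        rintro _ rfl
        exact hb _ (Finset.mem_insert_self _ _)
      obtain ⟨s, rfl⟩ := hbu
      rw [mul_assoc, heb _ fun t ht => hb t (Finset.mem_insert_of_mem ht)]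
      simp only [← mul_assoc, hu]

namespace SkewPBWExt

variable {R A : Type*} [Ring R] [Ring A] {n : ℕ} (E : SkewPBWExt R A n)

/-- Under compatibility, each `σᵢ` fixes every idempotent. -/
theorem SigmaDeltaCompatible.sigma_eq_self {E : SkewPBWExt R A n}
    (hcomp : E.SigmaDeltaCompatible) {e : R} (he : e * e = e) (i : Fin n) : E.σ i e = e := by
  have h1 := (hcomp (1 - e) e fun j => if j = i then 1 else 0).1.mp
    (by rw [sub_mul, one_mul, he, sub_self])
  have h2 := (hcomp e (1 - e) fun j => if j = i then 1 else 0).1.mp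
    (by rw [mul_sub, mul_one, he, sub_self])
  rw [sigmaPow_single] at h1 h2
  rw [sub_mul, one_mul, sub_eq_zero] at h1
  rw [map_sub, map_one, mul_sub, mul_one, sub_eq_zero] at h2
  exact h1.trans h2.symm

/-- Under compatibility, each `δᵢ` kills every central idempotent. -/
theorem SigmaDeltaCompatible.delta_eq_zero {E : SkewPBWExt R A n}
    (hcomp : E.SigmaDeltaCompatible) {e : R} (he : e * e = e) (hc : ∀ r, e * r = r * e)
    (i : Fin n) : E.δ i e = 0 := by
  have h1 := (hcomp (1 - e) e fun j => if j = i then 1 else 0).2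
    (by rw [sub_mul, one_mul, he, sub_self])
  rw [deltaPow_single, sub_mul, one_mul, sub_eq_zero] at h1
  have h2 := E.δ_leibniz i e e
  rw [he, hcomp.sigma_eq_self he, ← hc, ← h1] at h2
  exact left_eq_add.mp h2

/-- An element of `A` commuting with `R` and with all variables is central. -/
theorem commute_of_commute_generators {z : A} (hR : ∀ r, Commute z (E.ι r))
    (hx : ∀ i, Commute z (E.x i)) (f : A) : Commute z f := by
  obtain ⟨c, rfl, -⟩ := E.basis f
  refine Commute.sum_right _ _ _ fun α _ => (hR _).mul_right ?_
  refine Commute.list_prod_right _ _ fun y hy => ?_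
  obtain ⟨i, rfl⟩ := List.mem_ofFn.mp hy
  exact (hx i).pow_right _

/-- Under compatibility, central idempotents of `R` are central in `A`. -/
theorem SigmaDeltaCompatible.commute_idempotent {E : SkewPBWExt R A n}
    (hcomp : E.SigmaDeltaCompatible) {e : R} (he : e * e = e) (hc : ∀ r, e * r = r * e)
    (f : A) : Commute (E.ι e) f := by
  refine E.commute_of_commute_generators (fun r => ?_) (fun i => ?_) f
  · exact Commute.map (hc r) E.ι
  · have h := E.comm_rel i e
    rw [hcomp.sigma_eq_self he, hcomp.delta_eq_zero he hc, map_zero, add_zero] at h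
    exact h.symm

end SkewPBWExt

/-- If `R` is `(Σ,Δ)`-compatible, Abelian, NI, satisfies (SA1) and is a right
p.p.-ring, then the skew PBW extension `A` has Property (a.c.) on the right. -/
theorem rightPP_hasRightAC {R A : Type*} [Ring R] [Ring A] {n : ℕ} (E : SkewPBWExt R A n)
    (hcomp : E.SigmaDeltaCompatible) (hAb : IsAbelianRing R) (hNI : IsNIRing R)
    (hSA1 : E.SA1) (hpp : IsRightPP R) :
    HasRightAC A := by
  classical
  intro m a
  choose c hc using fun f => (E.basis f).exists
  let T : Finset R := Finset.univ.biUnion fun i => (c (a i)).support.image (c (a i))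
  obtain ⟨e, he, heT, heb⟩ := hpp.exists_idempotent_finset hAb T
  have hcoeff : ∀ i α, c (a i) α * e = 0 := by
    intro i α
    by_cases h : c (a i) α = 0
    · rw [h, zero_mul]
    · exact heT _ (Finset.mem_biUnion.mpr ⟨i, Finset.mem_univ _,
        Finset.mem_image_of_mem _ (Finsupp.mem_support_iff.mpr h)⟩)
  have hcen := hcomp.commute_idempotent he (hAb e he)
  have hae : ∀ i, a i * E.ι e = 0 := by
    intro i
    rw [← (hcen (a i)).eq, hc (a i), Finsupp.sum, Finset.mul_sum]
    refine Finset.sum_eq_zero fun α _ => ?_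
    rw [← mul_assoc, ← map_mul, hAb e he, hcoeff, map_zero, zero_mul]
  refine ⟨1 - E.ι e, Set.ext fun g => ⟨fun hg => ?_, fun hg => ?_⟩⟩
  · have hag : ∀ i, a i * g = 0 := fun i =>
      hg _ ⟨Pi.single i 1, by simp [Pi.single_apply]⟩
    have heg : E.ι e * g = g := by
      suffices h : E.ι e * ((c g).sum fun α r => E.ι r * monom E.x α) =
          (c g).sum fun α r => E.ι r * monom E.x α by rwa [← hc g] at h
      rw [Finsupp.sum, Finset.mul_sum]
      refine Finset.sum_congr rfl fun β _ => ?_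
      rw [← mul_assoc, ← map_mul, heb]
      intro t ht
      obtain ⟨i, -, hi⟩ := Finset.mem_biUnion.mp ht
      obtain ⟨α, -, rfl⟩ := Finset.mem_image.mp hi
      exact hSA1 _ _ (by rw [← hc, ← hc, hag]) α β
    rintro _ ⟨s, rfl⟩
    change (1 - E.ι e) * s * g = 0
    rw [sub_mul, one_mul, sub_mul, (hcen s).eq, mul_assoc, heg, sub_self]
  · rintro _ ⟨s, rfl⟩
    rw [Finset.sum_mul]
    refine Finset.sum_eq_zero fun i _ => ?_
    have h : (1 - E.ι e) * s i * g = 0 := hg _ ⟨s i, rfl⟩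
    have hi : a i = a i * (1 - E.ι e) := by rw [mul_sub, mul_one, hae, sub_zero]
    rw [hi, mul_assoc, mul_assoc, ← mul_assoc _ (s i), h, mul_zero]
end

section
/- Let A = σ(R)⟨x_1,…,x_n⟩ be a skew PBW extension of a ring R, where R is (Σ,Δ)-compatible, Abelian, NI, and satisfies condition (SA1). If R is a left p.p.-ring, then A has Property (a.c.) on the left. -/
/-- In an Abelian left p.p.-ring the left annihilator of a finite set is generated by an
idempotent. -/
theorem IsLeftPP.exists_idempotent_of_finite {R : Type*} [Ring R] (hAb : IsAbelianRing R)
    (hpp : IsLeftPP R) {S : Set R} (hS : S.Finite) :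
    ∃ e : R, e * e = e ∧ (∀ b ∈ S, e * b = 0) ∧ ∀ a, (∀ b ∈ S, a * b = 0) → a * e = a := by
  induction S, hS using Set.Finite.induction_on with
  | empty => exact ⟨1, by simp⟩
  | @insert b S _ _ ih =>
    obtain ⟨e, he, heS, hmax⟩ := ih
    obtain ⟨u, hu, hann⟩ := hpp b
    have hub : u * b = 0 := by
      have h : u ∈ lAnn {b} := hann ▸ ⟨u, hu⟩
      exact h b rfl
    have humax : ∀ a, a * b = 0 → a * u = a := by
      intro a ha
      have h : a ∈ lIdeal u := by
        rw [← hann]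
        rintro _ rfl
        exact ha
      obtain ⟨s, rfl⟩ := h
      simp only [mul_assoc, hu]
    refine ⟨e * u, ?_, ?_, ?_⟩
    · rw [mul_assoc, ← mul_assoc u, hAb u hu e, mul_assoc, hu, ← mul_assoc, he]
    · rintro c (rfl | hc)
      · rw [mul_assoc, hub, mul_zero]
      · rw [hAb e he u, mul_assoc, heS c hc, mul_zero]
    · intro a ha
      rw [← mul_assoc, hmax a fun c hc => ha c (Or.inr hc), humax a (ha b (Or.inl rfl))]

theorem foldr_comp_ofFn_iterate_zero {α : Type*} {n : ℕ} (f : Fin n → α → α) :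
    (List.ofFn fun j => (f j)^[0]).foldr (· ∘ ·) id = id := by
  induction n with
  | zero => simp
  | succ n ih =>
    rw [List.ofFn_succ, List.foldr_cons, ih fun j => f j.succ]
    rfl

theorem foldr_comp_ofFn_iterate_single {α : Type*} {n : ℕ} (f : Fin n → α → α) (i : Fin n) :
    (List.ofFn fun j => (f j)^[(Pi.single i 1 : Fin n → ℕ) j]).foldr (· ∘ ·) id = f i := by
  induction n with
  | zero => exact i.elim0
  | succ n ih =>
    rw [List.ofFn_succ, List.foldr_cons]
    cases i using Fin.cases with
    | zero =>
      have h : ∀ j : Fin n, (Pi.single (0 : Fin (n + 1)) 1 : Fin (n + 1) → ℕ) j.succ = 0 :=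
        fun j => Pi.single_eq_of_ne (Fin.succ_ne_zero j) 1
      simp only [h, Pi.single_eq_same]
      rw [foldr_comp_ofFn_iterate_zero fun j => f j.succ]
      rfl
    | succ i =>
      have h : ∀ j : Fin n, (Pi.single i.succ 1 : Fin (n + 1) → ℕ) j.succ =
          (Pi.single i 1 : Fin n → ℕ) j := fun j => by
        simp [Pi.single_apply]
      have h0 : (Pi.single i.succ 1 : Fin (n + 1) → ℕ) 0 = 0 :=
        Pi.single_eq_of_ne (Fin.succ_ne_zero i).symm 1
      simp only [h, h0]
      rw [ih fun j => f j.succ]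
      rfl

namespace SkewPBWExt

variable {R A : Type*} [Ring R] [Ring A] {n : ℕ} {E : SkewPBWExt R A n}

theorem SigmaDeltaCompatible.mul_sigma (h : E.SigmaDeltaCompatible) {a b : R} (hab : a * b = 0)
    (i : Fin n) : a * E.σ i b = 0 := by
  have := (h a b (Pi.single i 1)).1.1 hab
  rwa [sigmaPow, foldr_comp_ofFn_iterate_single (fun j => ⇑(E.σ j))] at this

theorem SigmaDeltaCompatible.mul_delta (h : E.SigmaDeltaCompatible) {a b : R} (hab : a * b = 0)
    (i : Fin n) : a * E.δ i b = 0 := by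
  have := (h a b (Pi.single i 1)).2 hab
  rwa [deltaPow, foldr_comp_ofFn_iterate_single] at this

theorem δ_one (E : SkewPBWExt R A n) (i : Fin n) : E.δ i 1 = 0 := by
  simpa using E.δ_leibniz i 1 1

theorem SigmaDeltaCompatible.sigma_idempotent (h : E.SigmaDeltaCompatible) {e : R}
    (he : e * e = e) (i : Fin n) : E.σ i e = e := by
  have h1 := h.mul_sigma (a := e) (b := 1 - e) (by rw [mul_sub, he, mul_one, sub_self]) i
  have h2 := h.mul_sigma (a := 1 - e) (b := e) (by rw [sub_mul, he, one_mul, sub_self]) i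
  rw [map_sub, map_one, mul_sub, mul_one, sub_eq_zero] at h1
  rw [sub_mul, one_mul, sub_eq_zero] at h2
  rw [h2, ← h1]

theorem SigmaDeltaCompatible.delta_idempotent (h : E.SigmaDeltaCompatible) {e : R}
    (he : e * e = e) (i : Fin n) : E.δ i e = 0 := by
  have h1 := h.mul_delta (a := e) (b := 1 - e) (by rw [mul_sub, he, mul_one, sub_self]) i
  have h2 := h.mul_delta (a := 1 - e) (b := e) (by rw [sub_mul, he, one_mul, sub_self]) i
  have hadd : E.δ i (1 - e) + E.δ i e = 0 := by rw [← E.δ_add, sub_add_cancel, E.δ_one]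
  rw [eq_neg_of_add_eq_zero_left hadd, mul_neg, neg_eq_zero] at h1
  rwa [sub_mul, one_mul, h1, sub_zero] at h2

/-- Idempotents of an Abelian `(Σ,Δ)`-compatible ring are central in the extension. -/
theorem SigmaDeltaCompatible.commute_idempotent_s3 (h : E.SigmaDeltaCompatible)
    (hAb : IsAbelianRing R) {e : R} (he : e * e = e) (f : A) : Commute (E.ι e) f := by
  obtain ⟨c, rfl, -⟩ := E.basis f
  refine Commute.sum_right _ _ _ fun α _ => Commute.mul_right ?_ ?_
  · exact Commute.map (show Commute e (c α) from hAb e he _) E.ι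
  · refine Commute.list_prod_right _ _ fun y hy => ?_
    obtain ⟨i, rfl⟩ := (List.mem_ofFn' _ _).1 hy
    refine Commute.pow_right (Commute.symm ?_) _
    have := E.comm_rel i e
    rwa [h.sigma_idempotent he, h.delta_idempotent he, map_zero, add_zero] at this

theorem ι_mul_sum_eq_zero (E : SkewPBWExt R A n) {r : R} {c : (Fin n → ℕ) →₀ R}
    (h : ∀ α, r * c α = 0) : E.ι r * (c.sum fun α s => E.ι s * monom E.x α) = 0 := by
  rw [Finsupp.sum, Finset.mul_sum]
  refine Finset.sum_eq_zero fun α _ => ?_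
  rw [← mul_assoc, ← map_mul, h, map_zero, zero_mul]

end SkewPBWExt

/-- If `R` is `(Σ,Δ)`-compatible, Abelian, NI, satisfies (SA1) and is a left
p.p.-ring, then the skew PBW extension `A` has Property (a.c.) on the left. -/
theorem leftPP_hasLeftAC {R A : Type*} [Ring R] [Ring A] {n : ℕ} (E : SkewPBWExt R A n)
    (hcomp : E.SigmaDeltaCompatible) (hAb : IsAbelianRing R) (hNI : IsNIRing R)
    (hSA1 : E.SA1) (hpp : IsLeftPP R) :
    HasLeftAC A := by
  intro m a
  choose c hc _ using fun i => E.basis (a i)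
  obtain ⟨e, he, hec, hmax⟩ := hpp.exists_idempotent_of_finite hAb
    (Set.finite_iUnion fun i => (c i).finite_range)
  have hcent := hcomp.commute_idempotent_s3 hAb he
  have hea : ∀ i, E.ι e * a i = 0 := fun i => by
    rw [hc i]
    exact E.ι_mul_sum_eq_zero fun α => hec _ (Set.mem_iUnion.2 ⟨i, α, rfl⟩)
  refine ⟨E.ι (1 - e), Set.ext fun g => ⟨fun hg => ?_, fun hg => ?_⟩⟩
  · obtain ⟨b, hb, -⟩ := E.basis g
    have hga : ∀ i, g * a i = 0 := fun i =>
      hg _ ⟨Pi.single i 1, by simp [Pi.single_apply]⟩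
    have hbe : ∀ α, b α * e = b α := fun α => hmax _ fun r hr => by
      obtain ⟨i, β, rfl⟩ := Set.mem_iUnion.1 hr
      exact hSA1 b (c i) (by rw [← hb, ← hc i, hga i]) α β
    have hg0 : E.ι (1 - e) * g = 0 := by
      rw [hb]
      refine E.ι_mul_sum_eq_zero fun α => ?_
      rw [sub_mul, one_mul, hAb e he, hbe, sub_self]
    rintro _ ⟨s, rfl⟩
    have hcomm : Commute (E.ι (1 - e)) (g * s) := by
      rw [map_sub, map_one]
      exact (Commute.one_left _).sub_left (hcent _)
    change g * (s * E.ι (1 - e)) = 0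
    rw [← mul_assoc, ← hcomm.eq, ← mul_assoc, hg0, zero_mul]
  · have hge : g = g * E.ι e := by
      have := hg _ ⟨1, one_mul _⟩
      rwa [map_sub, map_one, mul_sub, mul_one, sub_eq_zero] at this
    rintro _ ⟨s, rfl⟩
    rw [Finset.mul_sum]
    refine Finset.sum_eq_zero fun i _ => ?_
    rw [hge, mul_assoc, ← mul_assoc (E.ι e), (hcent (s i)).eq, mul_assoc, hea, mul_zero, mul_zero]
end
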